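/- Let C be a nontrivial near MDS (NMDS) code of length n and dimension k over GF(q), so that d(C) = n − k and d(C⊥) = k with k ≥ 2 and n − k ≥ 2. Then the minimum linear locality of C is either k − 1 or k. Moreover, if C⊥ is spanned as a GF(q)-vector space by its codewords of minimum weight k, then the minimum linear locality of C is k − 1. -/

import Mathlib

open scoped BigOperators

variable {F : Type*} [Field F] {ι : Type*} [Fintype ι]

/-- The Hamming weight of a word: the number of nonzero coordinates. -/
noncomputable def wt (c : ι → F) : ℕ := {i | c i ≠ 0}.ncard

/-- The minimum distance of a linear code: the least Hamming weight of a nonzero codeword. -/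
noncomputable def minDist (C : Submodule F (ι → F)) : ℕ :=
  sInf {w | ∃ c ∈ C, c ≠ 0 ∧ wt c = w}

/-- The dual code of a linear code. -/
def dualCode (C : Submodule F (ι → F)) : Submodule F (ι → F) where
  carrier := {x | ∀ c ∈ C, ∑ i, x i * c i = 0}
  add_mem' := by
    intro a b ha hb c hc
    have h1 := ha c hc
    have h2 := hb c hc
    simp only [Set.mem_setOf_eq, Pi.add_apply, add_mul, Finset.sum_add_distrib, h1, h2, add_zero]
  zero_mem' := by intro c hc; simp
  smul_mem' := by
    intro r a ha c hc
    have h := ha c hc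
    simp only [Set.mem_setOf_eq, Pi.smul_apply, smul_eq_mul, mul_assoc, ← Finset.mul_sum, h,
      mul_zero]

/-- `C` has linear locality `r`: every code symbol `c i` is a fixed linear combination of
at most `r` other code symbols. -/
def HasLinearLocality (C : Submodule F (ι → F)) (r : ℕ) : Prop :=
  ∀ i : ι, ∃ (R : Finset ι) (u : ι → F), i ∉ R ∧ R.card ≤ r ∧
    ∀ c ∈ C, c i = ∑ j ∈ R, u j * c j

theorem minDist_le_wt {C : Submodule F (ι → F)} {c : ι → F} (hc : c ∈ C) (h0 : c ≠ 0) :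
    minDist C ≤ wt c :=
  Nat.sInf_le ⟨c, hc, h0, rfl⟩

/-- A recovery rule for the symbol `i` gives a dual codeword whose support contains `i`. -/
theorem exists_mem_dualCode_of_recovery {C : Submodule F (ι → F)} {i : ι} {R : Finset ι}
    {u : ι → F} (hi : i ∉ R) (h : ∀ c ∈ C, c i = ∑ j ∈ R, u j * c j) :
    ∃ x ∈ dualCode C, x i ≠ 0 ∧ wt x ≤ R.card + 1 := by
  classical
  refine ⟨fun j => if j = i then 1 else if j ∈ R then -u j else 0, fun c hc => ?_, by simp, ?_⟩
  · have hs : ∀ j, (if j = i then 1 else if j ∈ R then -u j else 0) * c j =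
        (if j = i then c j else 0) - (if j ∈ R then u j * c j else 0) := by
      intro j
      by_cases hj : j = i
      · subst hj; simp [hi]
      · by_cases hR : j ∈ R <;> simp [hj, hR]
    simp only [hs, Finset.sum_sub_distrib]
    simp [h c hc, Finset.sum_ite_mem]
  · rw [← Finset.card_insert_of_notMem hi, ← Set.ncard_coe_finset]
    refine Set.ncard_le_ncard (fun j hj => ?_) (Finset.finite_toSet _)
    by_contra hn
    simp only [Finset.coe_insert, Set.mem_insert_iff, Finset.mem_coe, not_or] at hn
    simp [hn.1, hn.2] at hj

/-- A dual codeword whose support contains `i` gives a recovery rule for the symbol `i`. -/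
theorem exists_recovery_of_mem_dualCode {C : Submodule F (ι → F)} {i : ι} {x : ι → F}
    (hx : x ∈ dualCode C) (hi : x i ≠ 0) :
    ∃ (R : Finset ι) (u : ι → F), i ∉ R ∧ R.card ≤ wt x - 1 ∧
      ∀ c ∈ C, c i = ∑ j ∈ R, u j * c j := by
  classical
  have hw : wt x = (Finset.univ.filter fun j => x j ≠ 0).card := by
    rw [← Set.ncard_coe_finset]; simp [wt]
  refine ⟨(Finset.univ.filter fun j => x j ≠ 0).erase i, fun j => -(x j / x i),
    Finset.notMem_erase _ _, ?_, fun c hc => ?_⟩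
  · rw [Finset.card_erase_of_mem (by simp [hi]), hw]
  · have h : ∑ j, x j * c j = 0 := hx c hc
    rw [← Finset.sum_subset (Finset.subset_univ (Finset.univ.filter fun j => x j ≠ 0))
      (by simp +contextual),
      ← Finset.add_sum_erase _ _ (show i ∈ Finset.univ.filter fun j => x j ≠ 0 by simp [hi])] at h
    have hs : ∑ j ∈ (Finset.univ.filter fun j => x j ≠ 0).erase i, -(x j / x i) * c j =
        -(x i)⁻¹ * ∑ j ∈ (Finset.univ.filter fun j => x j ≠ 0).erase i, x j * c j := by
      rw [Finset.mul_sum]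
      exact Finset.sum_congr rfl fun j _ => by rw [div_eq_mul_inv]; ring
    rw [hs, eq_neg_of_add_eq_zero_right h]
    field_simp

theorem minDist_dualCode_le_of_hasLinearLocality [Nonempty ι] {C : Submodule F (ι → F)} {r : ℕ}
    (h : HasLinearLocality C r) : minDist (dualCode C) ≤ r + 1 := by
  obtain ⟨i⟩ := ‹Nonempty ι›
  obtain ⟨R, u, hi, hR, hu⟩ := h i
  obtain ⟨x, hx, hxi, hw⟩ := exists_mem_dualCode_of_recovery hi hu
  have := minDist_le_wt hx (fun h0 => hxi (by simp [h0]))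
  omega

/-- A code of minimum distance at least two has locality at most its dimension. -/
theorem hasLinearLocality_finrank {C : Submodule F (ι → F)} (hd : 2 ≤ minDist C) :
    HasLinearLocality C (Module.finrank F C) := by
  classical
  intro i
  let φ : ι → Module.Dual F C := fun j => (LinearMap.proj j).comp C.subtype
  let ψ : {j // j ≠ i} → Module.Dual F C := fun j => φ j
  have hker : ⨅ j, LinearMap.ker (ψ j) ≤ LinearMap.ker (φ i) := by
    intro c hc
    have hc' : ∀ j, j ≠ i → (c : ι → F) j = 0 := fun j hj =>
      LinearMap.mem_ker.1 ((Submodule.mem_iInf _).1 hc ⟨j, hj⟩)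
    by_contra hn
    have hci : (c : ι → F) i ≠ 0 := hn
    have h1 := minDist_le_wt c.2 (fun h0 => hci (by simp [h0]))
    have h2 : wt (c : ι → F) ≤ 1 := by
      rw [← Set.ncard_singleton i]
      refine Set.ncard_le_ncard (fun j hj => ?_)
      by_contra hne
      exact hj (hc' j hne)
    omega
  have hmem := mem_span_of_iInf_ker_le_ker hker
  obtain ⟨κ, a, ha, hspan, hli⟩ := exists_linearIndependent' F ψ
  have : Fintype κ := Fintype.ofInjective a ha
  rw [← hspan, Submodule.mem_span_range_iff_exists_fun] at hmem
  obtain ⟨v, hv⟩ := hmem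
  have hb : Function.Injective fun t => (a t : ι) := Subtype.val_injective.comp ha
  refine ⟨Finset.univ.image fun t => (a t : ι), Function.extend (fun t => (a t : ι)) v 0, ?_, ?_,
    fun c hc => ?_⟩
  · simp only [Finset.mem_image, Finset.mem_univ, true_and, not_exists]
    exact fun t => (a t).2
  · rw [Finset.card_image_of_injective _ hb, Finset.card_univ,
      ← Subspace.dual_finrank_eq (K := F) (V := C)]
    exact hli.fintype_card_le_finrank
  · rw [Finset.sum_image hb.injOn]
    have := LinearMap.congr_fun hv ⟨c, hc⟩
    simp only [hb.extend_apply]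
    simpa [φ, ψ, LinearMap.sum_apply] using this.symm

/-- If the dual code is spanned by a set of words of weight `w`, and every coordinate lies in the
support of a dual codeword, then the code has locality `w - 1`. -/
theorem HasLinearLocality.of_span_dualCode {C : Submodule F (ι → F)} {r w : ℕ}
    (h : HasLinearLocality C r)
    (hs : Submodule.span F {c : ι → F | c ∈ dualCode C ∧ wt c = w} = dualCode C) :
    HasLinearLocality C (w - 1) := by
  intro i
  obtain ⟨R, u, hi, -, hu⟩ := h i
  obtain ⟨x, hx, hxi, -⟩ := exists_mem_dualCode_of_recovery hi hu
  obtain ⟨y, ⟨hy, rfl⟩, hyi⟩ : ∃ y, (y ∈ dualCode C ∧ wt y = w) ∧ y i ≠ 0 := by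
    by_contra! hn
    have hle : Submodule.span F {c : ι → F | c ∈ dualCode C ∧ wt c = w} ≤
        LinearMap.ker (LinearMap.proj i : (ι → F) →ₗ[F] F) :=
      Submodule.span_le.2 fun y hy => hn y hy
    exact hxi (hle (hs.ge hx))
  exact exists_recovery_of_mem_dualCode hy hyi

/-- Let `C` be a nontrivial NMDS code of length `n` and dimension `k`
(so `d(C) = n - k` and `d(C⊥) = k` with `k ≥ 2`, `n - k ≥ 2`). Then the minimum linear locality
of `C` is either `k - 1` or `k`; moreover if `C⊥` is spanned by its minimum-weight codewords,
the minimum linear locality of `C` is `k - 1`. -/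
theorem statement14 (C : Submodule F (ι → F)) (n k : ℕ)
    (hn : Fintype.card ι = n) (hk : Module.finrank F C = k)
    (hk2 : 2 ≤ k) (hnk2 : 2 ≤ n - k)
    (hd : minDist C = n - k) (hd' : minDist (dualCode C) = k) :
    (IsLeast {r : ℕ | HasLinearLocality C r} (k - 1) ∨
      IsLeast {r : ℕ | HasLinearLocality C r} k) ∧
    (Submodule.span F {c : ι → F | c ∈ dualCode C ∧ wt c = k} = dualCode C →
      IsLeast {r : ℕ | HasLinearLocality C r} (k - 1)) := by
  have : Nonempty ι := Fintype.card_pos_iff.1 (by omega)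
  have hloc : HasLinearLocality C k := hk ▸ hasLinearLocality_finrank (by omega)
  have hlow : ∀ r, HasLinearLocality C r → k - 1 ≤ r := fun r hr => by
    have := minDist_dualCode_le_of_hasLinearLocality hr
    omega
  refine ⟨?_, fun hs => ⟨hloc.of_span_dualCode hs, hlow⟩⟩
  by_cases h : HasLinearLocality C (k - 1)
  · exact Or.inl ⟨h, hlow⟩
  · refine Or.inr ⟨hloc, fun r hr => ?_⟩
    have h1 := hlow r hr
    have h2 : r ≠ k - 1 := fun h2 => h (h2 ▸ hr)
    omega
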